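/- Let E be a finite-dimensional real inner product space, M ⊆ E a nonempty closed set, and R > 0. Assume M is R-proximally smooth: for every x ∈ E with dist(x, M) < R there is a unique point P_M(x) ∈ M with ‖x − P_M(x)‖ = dist(x, M). Then for every γ ∈ (0, R) and all x, y ∈ E with dist(x, M) ≤ γ and dist(y, M) ≤ γ, one has ‖P_M(x) − P_M(y)‖ ≤ (R/(R − γ)) ‖x − y‖. -/

import Mathlib

open Metric in
/-- One ascent step for the distance function along its gradient direction. -/
theorem prox_step {E : Type*} [NormedAddCommGroup E] [InnerProductSpace ℝ E]
    [FiniteDimensional ℝ E] (M : Set E) (hM : M.Nonempty) (hMc : IsClosed M)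
    (z : E) (hz : 0 < infDist z M)
    (hu : ∃! m : E, m ∈ M ∧ ‖z - m‖ = infDist z M)
    (c : ℝ) (hc : c < 1) (η : ℝ) (hη : 0 < η) :
    ∃ h : ℝ, 0 < h ∧ h < η ∧ ∃ w : E, ‖w - z‖ = h ∧ infDist z M + c * h ≤ infDist w M := by
  obtain ⟨m, ⟨hmM, hm⟩, huniq⟩ := hu
  set d := infDist z M with hd
  have hle : ∀ n ∈ M, d ≤ ‖z - n‖ := fun n hn => by
    rw [← dist_eq_norm]; exact infDist_le_dist_of_mem hn
  set g : E := d⁻¹ • (z - m) with hg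
  have hgn : ‖g‖ = 1 := by
    rw [hg, norm_smul, hm, norm_inv, Real.norm_of_nonneg hz.le, inv_mul_cancel₀ hz.ne']
  set K : Set E := (M ∩ closedBall z (d + 1)) ∩ {n | inner ℝ g (z - n) ≤ c * ‖z - n‖} with hK
  have hKc : IsCompact K := by
    have h1 : IsCompact (closedBall z (d + 1)) := isCompact_closedBall _ _
    have h2 : IsClosed {n : E | inner ℝ g (z - n) ≤ c * ‖z - n‖} :=
      isClosed_le (by fun_prop) (by fun_prop)
    exact (h1.inter_left hMc).inter_right h2
  have hmK : m ∉ K := by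
    rintro ⟨_, h⟩
    simp only [Set.mem_ofPred_eq] at h
    rw [hg, real_inner_smul_left, real_inner_self_eq_norm_sq, hm, sq, ← mul_assoc,
      inv_mul_cancel₀ hz.ne'] at h
    nlinarith
  obtain ⟨δ, hδ, hgap⟩ : ∃ δ : ℝ, 0 < δ ∧ ∀ n ∈ K, d + δ ≤ ‖z - n‖ := by
    rcases K.eq_empty_or_nonempty with he | hne
    · exact ⟨1, one_pos, fun n hn => by simp [he] at hn⟩
    · obtain ⟨n0, hn0, hmin⟩ := hKc.exists_isMinOn hne
        (f := fun n => ‖z - n‖) (by fun_prop)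
      have h1 : d ≠ ‖z - n0‖ := fun h => by
        have := huniq n0 ⟨hn0.1.1, h.symm⟩
        exact hmK (this ▸ hn0)
      have h2 := lt_of_le_of_ne (hle n0 hn0.1.1) h1
      refine ⟨‖z - n0‖ - d, by linarith, fun n hn => ?_⟩
      have : ‖z - n0‖ ≤ ‖z - n‖ := hmin hn
      linarith
  obtain ⟨h, hh, h1, h2, h3⟩ : ∃ h : ℝ, 0 < h ∧ h < η ∧ 2 * h < δ ∧ 2 * h < 1 := by
    have hp : 0 < min η (min δ 1) := lt_min hη (lt_min hδ one_pos)
    have a1 := min_le_left η (min δ 1)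
    have a2 := min_le_right η (min δ 1)
    have a3 := min_le_left δ 1
    have a4 := min_le_right δ 1
    exact ⟨min η (min δ 1) / 3, by linarith, by linarith, by linarith, by linarith⟩
  have hw : ‖(z + h • g) - z‖ = h := by
    rw [add_sub_cancel_left, norm_smul, hgn, Real.norm_of_nonneg hh.le, mul_one]
  refine ⟨h, hh, h1, z + h • g, hw, ?_⟩
  obtain ⟨n, hn, hnd⟩ := hMc.exists_infDist_eq_dist hM (z + h • g)
  rw [dist_eq_norm] at hnd
  have e1 : infDist (z + h • g) M ≤ d + h := by
    have := infDist_le_infDist_add_dist (s := M) (x := z + h • g) (y := z)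
    rw [dist_eq_norm, hw] at this
    exact this
  have e2 : ‖z - n‖ ≤ d + 2 * h := by
    have : ‖z - n‖ ≤ ‖z - (z + h • g)‖ + ‖(z + h • g) - n‖ := norm_sub_le_norm_sub_add_norm_sub _ _ _
    rw [norm_sub_rev z (z + h • g), hw, ← hnd] at this
    linarith
  have hnK : n ∉ K := fun hk => by have := hgap n hk; linarith
  have hin : c * ‖z - n‖ < inner ℝ g (z - n) := by
    by_contra hcon
    refine hnK ⟨⟨hn, ?_⟩, not_lt.1 hcon⟩
    rw [mem_closedBall, dist_comm, dist_eq_norm]; linarith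
  have hCS := real_inner_le_norm ((z + h • g) - n) (z - n)
  have hexp : inner ℝ ((z + h • g) - n) (z - n) = ‖z - n‖ ^ 2 + h * inner ℝ g (z - n) := by
    rw [show (z + h • g) - n = (z - n) + h • g by abel, inner_add_left,
      real_inner_self_eq_norm_sq, real_inner_smul_left]
  rw [hexp, ← hnd] at hCS
  have hpos : 0 < ‖z - n‖ := lt_of_lt_of_le hz (hle n hn)
  have hdn := hle n hn
  have : (‖z - n‖ + c * h) * ‖z - n‖ ≤ infDist (z + h • g) M * ‖z - n‖ := by
    nlinarith
  have := le_of_mul_le_mul_right this hpos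
  linarith

open Metric in
/-- Points of the open `R`-tube can be moved by `s` so that the distance grows by `s`. -/
theorem prox_ascent {E : Type*} [NormedAddCommGroup E] [InnerProductSpace ℝ E]
    [FiniteDimensional ℝ E] (M : Set E) (hM : M.Nonempty) (hMc : IsClosed M) (R : ℝ)
    (hprox : ∀ x : E, infDist x M < R → ∃! m : E, m ∈ M ∧ ‖x - m‖ = infDist x M)
    (x : E) (hx : 0 < infDist x M) (s : ℝ) (hs : 0 ≤ s) (hsR : infDist x M + s < R) :
    ∃ z : E, ‖z - x‖ ≤ s ∧ infDist x M + s ≤ infDist z M := by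
  have hB : IsCompact (closedBall x s) := isCompact_closedBall _ _
  have hne : (closedBall x s).Nonempty := ⟨x, mem_closedBall_self hs⟩
  have hcd : Continuous fun z : E => infDist z M := continuous_infDist_pt M
  obtain ⟨z, hz, hmax⟩ := hB.exists_isMaxOn hne hcd.continuousOn
  refine ⟨z, by simpa [dist_eq_norm] using hz, ?_⟩
  have key : ∀ c : ℝ, 0 ≤ c → c < 1 → infDist x M + c * s ≤ infDist z M := by
    intro c hc0 hc1
    obtain ⟨v, hv, hvmax⟩ := hB.exists_isMaxOn hne
      (f := fun z : E => infDist z M - c * ‖z - x‖) (by fun_prop)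
    have hvx : infDist x M - c * ‖x - x‖ ≤ infDist v M - c * ‖v - x‖ :=
      hvmax (mem_closedBall_self hs)
    rw [sub_self, norm_zero, mul_zero, sub_zero] at hvx
    have hvs : ‖v - x‖ ≤ s := by simpa [dist_eq_norm] using hv
    have hvz : infDist v M ≤ infDist z M := hmax hv
    rcases hvs.lt_or_eq with hlt | heq
    · exfalso
      have hcn : 0 ≤ c * ‖v - x‖ := by positivity
      have hvR : infDist v M < R := by
        have := infDist_le_infDist_add_dist (s := M) (x := v) (y := x)
        rw [dist_eq_norm] at this
        linarith
      obtain ⟨h, hh, hhs, w, hw, hwd⟩ := prox_step M hM hMc v (by linarith) (hprox v hvR)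
        ((1 + c) / 2) (by linarith) (s - ‖v - x‖) (by linarith)
      have htri : ‖w - x‖ ≤ ‖w - v‖ + ‖v - x‖ := norm_sub_le_norm_sub_add_norm_sub _ _ _
      have hwB : w ∈ closedBall x s := by
        rw [mem_closedBall, dist_eq_norm]; linarith
      have hwm : infDist w M - c * ‖w - x‖ ≤ infDist v M - c * ‖v - x‖ := hvmax hwB
      nlinarith [mul_le_mul_of_nonneg_left htri hc0]
    · rw [heq] at hvx; linarith
  by_contra hcon
  push Not at hcon
  have hzx : infDist x M ≤ infDist z M := by simpa using key 0 le_rfl one_pos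
  have hspos : 0 < s := by linarith
  have := key ((1 + (infDist z M - infDist x M) / s) / 2)
    (by have : 0 ≤ (infDist z M - infDist x M) / s := div_nonneg (by linarith) hs
        linarith)
    (by have : (infDist z M - infDist x M) / s < 1 := by rw [div_lt_one hspos]; linarith
        linarith)
  have e : ((1 + (infDist z M - infDist x M) / s) / 2) * s
      = (s + (infDist z M - infDist x M)) / 2 := by field_simp
  rw [e] at this
  linarith

open Metric in
/-- The proximal normal inequality with constant `1 / (2 R)`. -/
theorem prox_normal {E : Type*} [NormedAddCommGroup E] [InnerProductSpace ℝ E]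
    [FiniteDimensional ℝ E] (M : Set E) (hM : M.Nonempty) (hMc : IsClosed M) (R : ℝ)
    (hprox : ∀ x : E, infDist x M < R → ∃! m : E, m ∈ M ∧ ‖x - m‖ = infDist x M)
    (x p q : E) (hxR : infDist x M < R) (hp : ‖x - p‖ = infDist x M) (hpM : p ∈ M) (hq : q ∈ M) :
    2 * R * inner ℝ (x - p) (q - p) ≤ infDist x M * ‖q - p‖ ^ 2 := by
  rcases (infDist_nonneg (s := M) (x := x)).eq_or_lt with h0 | hpos
  · rw [← h0, norm_eq_zero] at hp
    simp [hp, ← h0]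
  set d := infDist x M with hd
  have key : ∀ t : ℝ, d < t → t < R →
      2 * t * inner ℝ (x - p) (q - p) ≤ d * ‖q - p‖ ^ 2 := by
    intro t ht htR
    obtain ⟨z, hz1, hz2⟩ := prox_ascent M hM hMc R hprox x hpos (t - d) (by linarith) (by linarith)
    rw [← hd, add_sub_cancel] at hz2
    have hzp : infDist z M ≤ ‖z - p‖ := by
      rw [← dist_eq_norm]; exact infDist_le_dist_of_mem hpM
    have hzq : infDist z M ≤ ‖z - q‖ := by
      rw [← dist_eq_norm]; exact infDist_le_dist_of_mem hq
    have htri : ‖z - p‖ ≤ ‖z - x‖ + ‖x - p‖ := norm_sub_le_norm_sub_add_norm_sub _ _ _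
    have hzx : ‖z - x‖ = t - d := by linarith
    have hzpt : ‖z - p‖ = t := by linarith
    have hray : SameRay ℝ (z - x) (x - p) := by
      rw [sameRay_iff_norm_add, sub_add_sub_cancel]; linarith
    have hr := hray.norm_smul_eq
    rw [hzx, hp] at hr
    have hr2 : d • (z - p) = t • (x - p) := by
      rw [← sub_add_sub_cancel z x p, smul_add, ← hr, ← add_smul]; congr 1; ring
    have hin : d * inner ℝ (z - p) (q - p) = t * inner ℝ (x - p) (q - p) := by
      rw [← real_inner_smul_left, hr2, real_inner_smul_left]
    have hexp : ‖z - q‖ ^ 2 = ‖z - p‖ ^ 2 - 2 * inner ℝ (z - p) (q - p) + ‖q - p‖ ^ 2 := by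
      rw [← norm_sub_sq_real, sub_sub_sub_cancel_right]
    have hge : t ^ 2 ≤ ‖z - q‖ ^ 2 := by
      apply pow_le_pow_left₀ (by linarith); linarith
    rw [hexp, hzpt] at hge
    have : 2 * inner ℝ (z - p) (q - p) ≤ ‖q - p‖ ^ 2 := by linarith
    nlinarith [mul_le_mul_of_nonneg_left this hpos.le]
  have hmem : R ∈ closure (Set.Ioo d R) := by
    rw [closure_Ioo hxR.ne]; exact ⟨hxR.le, le_rfl⟩
  have hcl : IsClosed {t : ℝ | 2 * t * inner ℝ (x - p) (q - p) ≤ d * ‖q - p‖ ^ 2} :=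
    isClosed_le (by fun_prop) (by fun_prop)
  exact closure_minimal (fun t ht => key t ht.1 ht.2) hcl hmem

/-- Lipschitz continuity of the nearest-point projection onto an `R`-proximally
smooth set on its `γ`-tube (equation (8) of the paper, due to
Clarke–Stern–Wolenski): if for every point at distance `< R` from `M` the
nearest point in `M` is unique, then any nearest-point projections `p, q` of
points `x, y` in the `γ`-tube (`0 < γ < R`) satisfy
`‖p − q‖ ≤ (R/(R − γ)) ‖x − y‖`. -/
theorem proximally_smooth_projection_lipschitz
    {E : Type*} [NormedAddCommGroup E] [InnerProductSpace ℝ E]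
    [FiniteDimensional ℝ E]
    (M : Set E) (hM : M.Nonempty) (hMc : IsClosed M)
    (R : ℝ) (hR : 0 < R)
    (hprox : ∀ x : E, Metric.infDist x M < R →
      ∃! m : E, m ∈ M ∧ ‖x - m‖ = Metric.infDist x M)
    (γ : ℝ) (hγ0 : 0 < γ) (hγR : γ < R)
    (x y : E) (hx : Metric.infDist x M ≤ γ) (hy : Metric.infDist y M ≤ γ)
    (p q : E)
    (hp : p ∈ M ∧ ‖x - p‖ = Metric.infDist x M)
    (hq : q ∈ M ∧ ‖y - q‖ = Metric.infDist y M) :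
    ‖p - q‖ ≤ (R / (R - γ)) * ‖x - y‖ := by
  have h1 := prox_normal M hM hMc R hprox x p q (by linarith) hp.2 hp.1 hq.1
  have h2 := prox_normal M hM hMc R hprox y q p (by linarith) hq.2 hq.1 hp.1
  have hRγ : 0 < R - γ := by linarith
  rw [norm_sub_rev q p] at h1
  have h1' : Metric.infDist x M * ‖p - q‖ ^ 2 ≤ γ * ‖p - q‖ ^ 2 :=
    mul_le_mul_of_nonneg_right hx (by positivity)
  have h2' : Metric.infDist y M * ‖p - q‖ ^ 2 ≤ γ * ‖p - q‖ ^ 2 :=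
    mul_le_mul_of_nonneg_right hy (by positivity)
  have hid : inner ℝ (x - p) (q - p) + inner ℝ (y - q) (p - q)
      = ‖p - q‖ ^ 2 - inner ℝ (x - y) (p - q) := by
    rw [← real_inner_self_eq_norm_sq]
    simp only [inner_sub_left, inner_sub_right]
    rw [real_inner_comm q p]
    ring
  have hcs := real_inner_le_norm (x - y) (p - q)
  have hmain : (R - γ) * ‖p - q‖ ^ 2 ≤ R * (‖x - y‖ * ‖p - q‖) := by
    have := mul_le_mul_of_nonneg_left hcs hR.le
    have hid2 := congrArg (2 * R * ·) hid
    beta_reduce at hid2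
    nlinarith
  rw [div_mul_eq_mul_div, le_div_iff₀ hRγ]
  rcases (norm_nonneg (p - q)).eq_or_lt with h0 | hpos
  · rw [← h0, zero_mul]; positivity
  · apply le_of_mul_le_mul_right _ hpos
    nlinarith
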